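/- Let (A, m) be a demi local ring which is finite over a central subring R, and put m_R = m ∩ R. Then (A, m) is a quasi local ring if and only if the m-adic topology on A coincides with the m_R·A-adic topology, namely, if and only if there exists a positive integer k₀ such that m^{k₀} ⊆ m_R·A (where m_R·A denotes the two-sided ideal of A generated by m_R). -/

import Mathlib

/-- For a two-sided ideal `I` of `A` and a left `A`-module `M`, the submodule `I • M`
of `M` generated by the products `a • y` with `a ∈ I`, `y ∈ M`. -/
def idealSmulSpan {A : Type*} [Ring A] (I : TwoSidedIdeal A)
    (M : Type*) [AddCommGroup M] [Module A M] : Submodule A M :=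
  Submodule.span A {x : M | ∃ a ∈ I, ∃ y : M, a • y = x}

theorem TwoSidedIdeal.exists_le_isCoatom {A : Type*} [Ring A] {I : TwoSidedIdeal A}
    (hI : I ≠ ⊤) : ∃ m : TwoSidedIdeal A, IsCoatom m ∧ I ≤ m := by
  have : IsCoatomic (TwoSidedIdeal A) := by
    refine IsCoatomic.of_isChain_bounded fun {c} hc hne htop ↦ ?_
    obtain ⟨J₀, hJ₀⟩ := hne
    refine ⟨TwoSidedIdeal.mk' (⋃ J ∈ c, (J : Set A)) ?_ ?_ ?_ ?_ ?_, ?_, ?_⟩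
    · exact Set.mem_biUnion hJ₀ J₀.zero_mem
    · intro x y hx hy
      simp only [Set.mem_iUnion, SetLike.mem_coe, exists_prop] at hx hy ⊢
      obtain ⟨J, hJ, hx⟩ := hx
      obtain ⟨K, hK, hy⟩ := hy
      rcases hc.total hJ hK with h | h
      · exact ⟨K, hK, K.add_mem (h hx) hy⟩
      · exact ⟨J, hJ, J.add_mem hx (h hy)⟩
    · intro x hx
      simp only [Set.mem_iUnion, SetLike.mem_coe, exists_prop] at hx ⊢
      exact hx.imp fun J h ↦ ⟨h.1, J.neg_mem h.2⟩
    · intro x y hy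
      simp only [Set.mem_iUnion, SetLike.mem_coe, exists_prop] at hy ⊢
      exact hy.imp fun J h ↦ ⟨h.1, J.mul_mem_left _ _ h.2⟩
    · intro x y hx
      simp only [Set.mem_iUnion, SetLike.mem_coe, exists_prop] at hx ⊢
      exact hx.imp fun J h ↦ ⟨h.1, J.mul_mem_right _ _ h.2⟩
    · intro h
      rw [← TwoSidedIdeal.one_mem_iff, TwoSidedIdeal.mem_mk'] at h
      simp only [Set.mem_iUnion, SetLike.mem_coe, exists_prop] at h
      obtain ⟨J, hJ, h⟩ := h
      exact htop (J.one_mem_iff.mp h ▸ hJ)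
    · intro J hJ x hx
      rw [TwoSidedIdeal.mem_mk']
      exact Set.mem_biUnion hJ hx
  exact (eq_top_or_exists_le_coatom I).resolve_left hI

theorem TwoSidedIdeal.mk'_eq_zero_iff {A : Type*} [Ring A] {m : TwoSidedIdeal A} {x : A} :
    m.ringCon.mk' x = 0 ↔ x ∈ m := by
  rw [← TwoSidedIdeal.mem_ker, TwoSidedIdeal.ker_ringCon_mk']

theorem TwoSidedIdeal.isSimpleRing_quotient {A : Type*} [Ring A] {m : TwoSidedIdeal A}
    (hm : IsCoatom m) : IsSimpleRing m.ringCon.Quotient := by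
  have : Nontrivial m.ringCon.Quotient := by
    refine ⟨⟨1, 0, fun h ↦ hm.1 ?_⟩⟩
    rw [← TwoSidedIdeal.one_mem_iff, ← TwoSidedIdeal.mk'_eq_zero_iff, map_one, h]
  refine IsSimpleRing.of_eq_bot_or_eq_top fun J ↦ ?_
  have hle : m ≤ J.comap m.ringCon.mk' := fun x hx ↦ by
    rw [TwoSidedIdeal.mem_comap, TwoSidedIdeal.mk'_eq_zero_iff.mpr hx]
    exact J.zero_mem
  rcases hm.le_iff.mp hle with h | h
  · right
    rw [← TwoSidedIdeal.one_mem_iff, ← map_one m.ringCon.mk', ← TwoSidedIdeal.mem_comap, h]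
    trivial
  · left
    refine eq_bot_iff.mpr fun y hy ↦ ?_
    obtain ⟨x, rfl⟩ := m.ringCon.mk'_surjective y
    rw [← TwoSidedIdeal.mem_comap, h] at hy
    exact TwoSidedIdeal.mk'_eq_zero_iff.mpr hy

theorem IsSimpleRing.isMaximal_ker_algebraMap (R : Type*) {S : Type*} [CommRing R] [Ring S]
    [Algebra R S] [Module.Finite R S] [IsSimpleRing S] :
    (RingHom.ker (algebraMap R S)).IsMaximal := by
  have hint : Algebra.IsIntegral R (Subalgebra.center R S) :=
    ⟨fun x ↦ (isIntegral_algHom_iff (Subalgebra.center R S).val Subtype.val_injective).mp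
      (Algebra.IsIntegral.isIntegral (x : S))⟩
  have hfield : IsField (Subalgebra.center R S) := IsSimpleRing.isField_center S
  have hker : RingHom.ker (algebraMap R S) =
      RingHom.ker (algebraMap R (Subalgebra.center R S)) := by
    ext r
    rw [RingHom.mem_ker, RingHom.mem_ker, Subtype.ext_iff]
    rfl
  have : (⊥ : Ideal (Subalgebra.center R S)).IsMaximal :=
    Ring.isField_iff_maximal_bot.mp hfield
  rw [hker]
  exact @Ideal.isMaximal_comap_of_isIntegral_of_isMaximal R _
    (Subalgebra.center R S) _ _ hint ⊥ this

theorem Module.isNoetherian_and_isArtinian_of_isMaximal {R M : Type*} [CommRing R] [AddCommGroup M]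
    [Module R M] [Module.Finite R M] (I : Ideal R) [I.IsMaximal]
    (hI : ∀ r ∈ I, ∀ x : M, r • x = 0) : IsNoetherian R M ∧ IsArtinian R M := by
  have htors : Module.IsTorsionBySet R M I := fun x r ↦ hI r r.2 x
  let := htors.module
  let := Ideal.Quotient.field I
  have : IsScalarTower R (R ⧸ I) M := htors.isScalarTower
  have : Module.Finite (R ⧸ I) M := Module.Finite.of_restrictScalars_finite R _ _
  let e : Submodule R M ≃o Submodule (R ⧸ I) M :=
    (Submodule.orderIsoOfAlgebraMapSurjective (S := R ⧸ I) Ideal.Quotient.mk_surjective).symm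
  exact ⟨isNoetherian_iff'.mpr e.toOrderEmbedding.wellFoundedGT,
    e.toOrderEmbedding.wellFoundedLT⟩

theorem TwoSidedIdeal.eq_top_of_prod_smul_mem {A M : Type*} [Ring A] [AddCommGroup M]
    [Module A M] {m : TwoSidedIdeal A} (hm : idealSmulSpan m M = ⊤) (k : ℕ)
    (N : Submodule A M)
    (hN : ∀ x : Fin k → A, (∀ i, x i ∈ m) → ∀ y : M, (List.ofFn x).prod • y ∈ N) : N = ⊤ := by
  induction k with
  | zero => exact eq_top_iff.mpr fun y _ ↦ by simpa using hN Fin.elim0 (fun i ↦ i.elim0) y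
  | succ k ih =>
    refine ih fun x hx z ↦ ?_
    have hz : z ∈ idealSmulSpan m M := hm ▸ Submodule.mem_top
    suffices ∀ c : A, (List.ofFn x).prod • c • z ∈ N by simpa using this 1
    induction hz using Submodule.span_induction with
    | mem z hz =>
      obtain ⟨a, ha, y, rfl⟩ := hz
      intro c
      have := hN (Fin.snoc x (c * a)) (fun i ↦ by
        refine Fin.lastCases ?_ (fun j ↦ ?_) i
        · simpa using m.mul_mem_left c a ha
        · simpa using hx j) y
      rw [List.ofFn_succ'] at this
      simpa [List.concat_eq_append, -List.ofFn_succ, mul_smul] using this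
    | zero => simp
    | add z w _ _ hz hw => exact fun c ↦ by simpa using N.add_mem (hz c) (hw c)
    | smul a z _ hz => exact fun c ↦ by simpa [mul_smul] using hz (c * a)

/-- A maximal two-sided ideal of a ring finite over a commutative ring contracts to a maximal
ideal, and the quotient by it is Artinian. -/
theorem TwoSidedIdeal.isMaximal_comap_and_isArtinianRing_quotient (R : Type*) {A : Type*}
    [CommRing R] [Ring A]
    [Algebra R A] [Module.Finite R A] {m : TwoSidedIdeal A} (hm : IsCoatom m) :
    (Ideal.comap (algebraMap R A) m.asIdeal).IsMaximal ∧ IsArtinianRing m.ringCon.Quotient := by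
  have := TwoSidedIdeal.isSimpleRing_quotient hm
  let f : A →ₐ[R] m.ringCon.Quotient := { m.ringCon.mk' with commutes' := fun _ ↦ rfl }
  have : Module.Finite R m.ringCon.Quotient :=
    Module.Finite.of_surjective f.toLinearMap m.ringCon.mk'_surjective
  have hmax := IsSimpleRing.isMaximal_ker_algebraMap R (S := m.ringCon.Quotient)
  have hker : RingHom.ker (algebraMap R m.ringCon.Quotient) =
      Ideal.comap (algebraMap R A) m.asIdeal := by
    ext r
    rw [RingHom.mem_ker, ← f.commutes, Ideal.mem_comap, TwoSidedIdeal.mem_asIdeal]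
    exact TwoSidedIdeal.mk'_eq_zero_iff
  refine ⟨hker ▸ hmax, isArtinian_of_tower R
    (Module.isNoetherian_and_isArtinian_of_isMaximal
      (RingHom.ker (algebraMap R m.ringCon.Quotient)) ?_).2⟩
  intro r hr x
  rw [Algebra.smul_def, RingHom.mem_ker.mp hr, zero_mul]

theorem TwoSidedIdeal.subsingleton_of_prod_mem {R A M : Type*} [CommRing R] [Ring A]
    [Algebra R A] [Module.Finite R A] {m : TwoSidedIdeal A} (hm : m ≠ ⊤)
    (huniq : ∀ m' : TwoSidedIdeal A, IsCoatom m' → m' = m) {k : ℕ}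
    (hk : ∀ x : Fin k → A, (∀ i, x i ∈ m) →
      (List.ofFn x).prod ∈ Ideal.map (algebraMap R A) (Ideal.comap (algebraMap R A) m.asIdeal))
    [AddCommGroup M] [Module A M] [Module.Finite A M] (hM : idealSmulSpan m M = ⊤) :
    Subsingleton M := by
  let : Module R M := Module.compHom M (algebraMap R A)
  have : IsScalarTower R A M := IsScalarTower.of_algebraMap_smul fun _ _ ↦ rfl
  have : Module.Finite R M := Module.Finite.trans A M
  set I := Ideal.comap (algebraMap R A) m.asIdeal
  let N : Submodule A M :=
    { (I • ⊤ : Submodule R M) with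
      smul_mem' := fun a z hz ↦ by
        change z ∈ I • (⊤ : Submodule R M) at hz
        change a • z ∈ I • (⊤ : Submodule R M)
        induction hz using Submodule.smul_induction_on' with
        | smul r hr y hy =>
          rw [smul_comm]
          exact Submodule.smul_mem_smul hr Submodule.mem_top
        | add y _ z _ hy hz =>
          rw [smul_add]
          exact Submodule.add_mem _ hy hz }
  have hN : N = ⊤ := TwoSidedIdeal.eq_top_of_prod_smul_mem hM k N fun x hx y ↦ by
    have hle : Ideal.map (algebraMap R A) I ≤ N.comap (LinearMap.toSpanSingleton A M y) := by
      refine Ideal.span_le.mpr ?_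
      rintro _ ⟨r, hr, rfl⟩
      change algebraMap R A r • y ∈ I • (⊤ : Submodule R M)
      rw [algebraMap_smul]
      exact Submodule.smul_mem_smul hr Submodule.mem_top
    exact hle (hk x hx)
  obtain ⟨r, hr, hrM⟩ := Submodule.exists_sub_one_mem_and_smul_eq_zero_of_fg_of_le_smul I
    (⊤ : Submodule R M) Module.Finite.fg_top (fun y _ ↦ (hN ▸ Submodule.mem_top : y ∈ N))
  by_contra hsub
  let J : TwoSidedIdeal A := TwoSidedIdeal.ker (Module.toAddMonoidEnd A M)
  have hJ : J ≠ ⊤ := fun h ↦ hsub <| by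
    have h1 : (1 : A) ∈ J := h ▸ trivial
    rw [TwoSidedIdeal.mem_ker, map_one] at h1
    exact subsingleton_of_forall_eq 0 fun y ↦ DFunLike.congr_fun h1 y
  obtain ⟨m', hm', hle⟩ := TwoSidedIdeal.exists_le_isCoatom hJ
  rw [huniq m' hm'] at hle
  have hrm : algebraMap R A r ∈ m := hle <| by
    rw [TwoSidedIdeal.mem_ker]
    ext y
    exact hrM y Submodule.mem_top
  have hrm' : algebraMap R A (r - 1) ∈ m := hr
  rw [map_sub, map_one] at hrm'
  refine hm (m.one_mem_iff.mp ?_)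
  simpa using m.sub_mem hrm hrm'

/-- The chain `M ≥ m • M ≥ m • (m • M) ≥ …` of submodules of `M`. -/
def TwoSidedIdeal.iterSmul {A : Type*} [Ring A] (m : TwoSidedIdeal A) (M : Type*)
    [AddCommGroup M] [Module A M] : ℕ → Submodule A M
  | 0 => ⊤
  | k + 1 => Submodule.span A {x | ∃ a ∈ m, ∃ y ∈ m.iterSmul M k, a • y = x}

section iterSmul

variable {A M : Type*} [Ring A] (m : TwoSidedIdeal A) [AddCommGroup M] [Module A M]

theorem TwoSidedIdeal.antitone_iterSmul : Antitone (m.iterSmul M) := by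
  refine antitone_nat_of_succ_le fun k ↦ Submodule.span_le.mpr ?_
  rintro _ ⟨a, -, y, hy, rfl⟩
  exact Submodule.smul_mem _ a hy

theorem TwoSidedIdeal.prod_smul_mem_iterSmul (k : ℕ) (x : Fin k → A) (hx : ∀ i, x i ∈ m)
    (y : M) : (List.ofFn x).prod • y ∈ m.iterSmul M k := by
  induction k with
  | zero => exact Submodule.mem_top
  | succ k ih =>
    rw [List.ofFn_succ, List.prod_cons, mul_smul]
    exact Submodule.subset_span ⟨x 0, hx 0, _, ih _ fun i ↦ hx i.succ, rfl⟩

theorem TwoSidedIdeal.idealSmulSpan_iterSmul_eq_top {k : ℕ}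
    (hk : m.iterSmul M k = m.iterSmul M (k + 1)) :
    idealSmulSpan m (m.iterSmul M k) = ⊤ := by
  have hle : m.iterSmul M (k + 1) ≤
      (idealSmulSpan m (m.iterSmul M k)).map (m.iterSmul M k).subtype := by
    refine Submodule.span_le.mpr ?_
    rintro _ ⟨a, ha, y, hy, rfl⟩
    exact ⟨a • ⟨y, hy⟩, Submodule.subset_span ⟨a, ha, _, rfl⟩, rfl⟩
  refine eq_top_iff.mpr fun y _ ↦ ?_
  obtain ⟨z, hz, hzy⟩ := hle (hk.le y.2)
  rwa [← (Subtype.val_injective hzy : z = y)]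

end iterSmul

theorem TwoSidedIdeal.exists_prod_mem_of_nakayama.{u} {R : Type*} {A : Type u} [CommRing R]
    [Ring A] [Algebra R A] [Module.Finite R A] {m : TwoSidedIdeal A} (hm : IsCoatom m)
    (hnak : ∀ (M : Type u) [AddCommGroup M] [Module A M], Module.Finite A M →
      idealSmulSpan m M = ⊤ → Subsingleton M) :
    ∃ k : ℕ, 0 < k ∧ ∀ x : Fin k → A, (∀ i, x i ∈ m) →
      (List.ofFn x).prod ∈ Ideal.map (algebraMap R A)
        (Ideal.comap (algebraMap R A) m.asIdeal) := by
  set I := Ideal.comap (algebraMap R A) m.asIdeal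
  have : I.IsMaximal := (TwoSidedIdeal.isMaximal_comap_and_isArtinianRing_quotient R hm).1
  let J := Ideal.map (algebraMap R A) I
  have : Module.Finite R (A ⧸ J) :=
    Module.Finite.of_surjective (J.mkQ.restrictScalars R) J.mkQ_surjective
  obtain ⟨hnoeth, hart⟩ := Module.isNoetherian_and_isArtinian_of_isMaximal (M := A ⧸ J) I
    fun r hr x ↦ by
    obtain ⟨a, rfl⟩ := J.mkQ_surjective x
    rw [← LinearMap.map_smul_of_tower, Submodule.mkQ_apply, Submodule.Quotient.mk_eq_zero,
      Algebra.smul_def, Algebra.commutes]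
    exact J.mul_mem_left a (Ideal.mem_map_of_mem _ hr)
  have : IsNoetherian A (A ⧸ J) := isNoetherian_of_tower R hnoeth
  have : IsArtinian A (A ⧸ J) := isArtinian_of_tower R hart
  obtain ⟨n, hn⟩ := IsArtinian.monotone_stabilizes
    ⟨fun k ↦ OrderDual.toDual (m.iterSmul (A ⧸ J) k), m.antitone_iterSmul⟩
  have hstep : m.iterSmul (A ⧸ J) n = m.iterSmul (A ⧸ J) (n + 1) := hn (n + 1) n.le_succ
  have hsub := hnak _ inferInstance (m.idealSmulSpan_iterSmul_eq_top hstep)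
  refine ⟨n + 1, n.succ_pos, fun x hx ↦ ?_⟩
  have hmem := m.prod_smul_mem_iterSmul (n + 1) x hx (J.mkQ 1)
  rw [← hstep, Submodule.subsingleton_iff_eq_bot.mp hsub, Submodule.mem_bot, ← map_smul,
    Submodule.mkQ_apply, Submodule.Quotient.mk_eq_zero, smul_eq_mul, mul_one] at hmem
  exact hmem

/-- Let `(A, m)` be a demi local ring which is finite over a central
subring `R`, and put `m_R = m ∩ R`.  Then `(A, m)` is quasi local (Nakayama's lemma
holds for `(A, m)` and `A/m` is simple Artinian) if and only if the `m`-adic topology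
coincides with the `m_R·A`-adic topology, namely iff `m^{k₀} ⊆ m_R·A` for some positive
integer `k₀` (containment being expressed by: every product of `k₀` elements of `m`
lies in the ideal of `A` generated by `m_R`). -/
theorem demiLocal_quasiLocal_iff_adic.{u} {A : Type u} [Ring A] (m : TwoSidedIdeal A)
    (hmax : IsCoatom m) (huniq : ∀ m' : TwoSidedIdeal A, IsCoatom m' → m' = m)
    (R : Subring A) (hcent : ∀ r ∈ R, ∀ a : A, r * a = a * r)
    [Module.Finite R A] :
    ((∀ (M : Type u) [AddCommGroup M] [Module A M], Module.Finite A M →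
        idealSmulSpan m M = ⊤ → Subsingleton M) ∧
      IsSimpleRing m.ringCon.Quotient ∧ IsArtinianRing m.ringCon.Quotient) ↔
    (∃ k₀ : ℕ, 0 < k₀ ∧ ∀ x : Fin k₀ → A, (∀ i, x i ∈ m) →
      (List.ofFn x).prod ∈ Ideal.map R.subtype (Ideal.comap R.subtype m.asIdeal)) := by
  have inst := ‹Module.Finite R A›
  let : CommRing R :=
    { (inferInstance : Ring R) with mul_comm := fun r s ↦ Subtype.ext (hcent r r.2 s) }
  let : Algebra R A := R.subtype.toAlgebra' fun r a ↦ hcent r r.2 a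
  have hfin : Module.Finite R A := inst
  refine ⟨fun h ↦ TwoSidedIdeal.exists_prod_mem_of_nakayama (R := R) hmax h.1, ?_⟩
  rintro ⟨k, -, hk⟩
  refine ⟨fun M _ _ _ hM ↦ TwoSidedIdeal.subsingleton_of_prod_mem (R := R) hmax.1 huniq hk hM,
    TwoSidedIdeal.isSimpleRing_quotient hmax,
    (TwoSidedIdeal.isMaximal_comap_and_isArtinianRing_quotient R hmax).2⟩
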